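/- (Chain Shifting Lemma) Let R = [r] × [s] and let 1 < u ≤ v ≤ s. Define the intervals I = [1,r] × [u,v] and I' = [1,r] × [u−1,v−1] of R. Then for any labeling x ∈ ℝ_{>0}^R and any 0 ≤ k ≤ v − u + 1, w_I^{(k)}(x) = w_{I'}^{(k)}(φ(ρ⁻¹(φ⁻¹(x)))). -/

import Mathlib

namespace Paper

/-- Membership in the rectangle poset `R = [1,r] × [1,s]` (coordinates in `ℤ`). -/
def inR (r s : ℕ) (p : ℤ × ℤ) : Prop :=
  1 ≤ p.1 ∧ p.1 ≤ (r : ℤ) ∧ 1 ≤ p.2 ∧ p.2 ≤ (s : ℤ)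

instance (r s : ℕ) : DecidablePred (inR r s) := fun _ => by unfold inR; infer_instance

/-- The cover relation in the product of two chains. -/
def CoverStep (p q : ℤ × ℤ) : Prop :=
  (q.1 = p.1 + 1 ∧ q.2 = p.2) ∨ (q.1 = p.1 ∧ q.2 = p.2 + 1)

/-- Upper covers of `p` inside the rectangle. -/
def upSet (r s : ℕ) (p : ℤ × ℤ) : Finset (ℤ × ℤ) :=
  ({(p.1 + 1, p.2), (p.1, p.2 + 1)} : Finset (ℤ × ℤ)).filter (inR r s)

/-- Lower covers of `p` inside the rectangle. -/
def downSet (r s : ℕ) (p : ℤ × ℤ) : Finset (ℤ × ℤ) :=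
  ({(p.1 - 1, p.2), (p.1, p.2 - 1)} : Finset (ℤ × ℤ)).filter (inR r s)

/-- Sum of the labels of the lower covers of `p` (empty sum = 1). -/
noncomputable def dsum (r s : ℕ) (x : ℤ × ℤ → ℝ) (p : ℤ × ℤ) : ℝ :=
  if (downSet r s p).Nonempty then ∑ q ∈ downSet r s p, x q else 1

/-- Parallel sum of the labels of the upper covers of `p` (empty parallel sum = 1). -/
noncomputable def usum (r s : ℕ) (x : ℤ × ℤ → ℝ) (p : ℤ × ℤ) : ℝ :=
  if (upSet r s p).Nonempty then (∑ q ∈ upSet r s p, (x q)⁻¹)⁻¹ else 1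

/-- The birational toggle at `p`. -/
noncomputable def toggle (r s : ℕ) (p : ℤ × ℤ) (x : ℤ × ℤ → ℝ) : ℤ × ℤ → ℝ :=
  fun q => if q = p then usum r s x p * dsum r s x p / x p else x q

/-- The elements of `[1,a] × [1,b]` listed from top to bottom
(descending lexicographic order, the reverse of a linear extension). -/
def rectList (a b : ℕ) : List (ℤ × ℤ) :=
  (List.range a).reverse.flatMap fun i =>
    (List.range b).reverse.map fun j => ((i : ℤ) + 1, (j : ℤ) + 1)

/-- Birational rowmotion on the rectangle: toggles from top to bottom. -/
noncomputable def rho (r s : ℕ) (x : ℤ × ℤ → ℝ) : ℤ × ℤ → ℝ :=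
  (rectList r s).foldl (fun y p => toggle r s p y) x

/-- Inverse birational rowmotion: toggles from bottom to top. -/
noncomputable def rhoInv (r s : ℕ) (x : ℤ × ℤ → ℝ) : ℤ × ℤ → ℝ :=
  (rectList r s).reverse.foldl (fun y p => toggle r s p y) x

/-- Integer powers of birational rowmotion. -/
noncomputable def rhoPow (r s : ℕ) (k : ℤ) (x : ℤ × ℤ → ℝ) : ℤ × ℤ → ℝ :=
  if 0 ≤ k then (rho r s)^[k.toNat] x else (rhoInv r s)^[(-k).toNat] x

/-- Saturated chains from `a` to `b`, as lists of successive cover steps. -/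
def ChainList (a b : ℤ × ℤ) : Type :=
  {l : List (ℤ × ℤ) // l.Chain' CoverStep ∧ l.head? = some a ∧ l.getLast? = some b}

/-- The inverse birational transfer map on the rectangle: `φ⁻¹(x)_p` is the total weight
of all saturated chains from the minimal element `(1,1)` to `p`. -/
noncomputable def phiInv (x : ℤ × ℤ → ℝ) : ℤ × ℤ → ℝ :=
  fun p => ∑ᶠ c : ChainList (1, 1) p, (c.1.map x).prod

/-- The birational transfer map `φ(x)_p = x_p / ∑_{q ⋖ p} x_q`. -/
noncomputable def phi (r s : ℕ) (x : ℤ × ℤ → ℝ) : ℤ × ℤ → ℝ :=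
  fun p => x p / dsum r s x p

/-- A collection of `k` pairwise vertex-disjoint lattice paths in the interval
`[i₁,i₂] × [j₁,j₂]`, from `(i₁,j₁),…,(i₁,j₁+k-1)` to `(i₂,j₂-k+1),…,(i₂,j₂)`. -/
structure RSys (i₁ i₂ j₁ j₂ : ℤ) (k : ℕ) where
  path : Fin k → List (ℤ × ℤ)
  chain : ∀ t, (path t).Chain' CoverStep
  mem : ∀ t, ∀ v ∈ path t, i₁ ≤ v.1 ∧ v.1 ≤ i₂ ∧ j₁ ≤ v.2 ∧ v.2 ≤ j₂
  first : ∀ t : Fin k, (path t).head? = some (i₁, j₁ + ((t : ℕ) : ℤ))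
  final : ∀ t : Fin k, (path t).getLast? = some (i₂, j₂ - k + 1 + ((t : ℕ) : ℤ))
  disjoint : ∀ t t' : Fin k, t ≠ t' → ∀ v ∈ path t, v ∉ path t'

/-- The weight of a collection of paths: the product of labels of all its elements. -/
noncomputable def RSysWeight (x : ℤ × ℤ → ℝ) {i₁ i₂ j₁ j₂ : ℤ} {k : ℕ}
    (L : RSys i₁ i₂ j₁ j₂ k) : ℝ :=
  ∏ t : Fin k, ((L.path t).map x).prod

/-- `w_I^{(k)}(x)`: total weight of all collections of `k` nonintersecting paths in the
interval `I = [i₁,i₂] × [j₁,j₂]` (with `w_I^{(0)} = 1`). -/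
noncomputable def w (i₁ i₂ j₁ j₂ : ℤ) (k : ℤ) (x : ℤ × ℤ → ℝ) : ℝ :=
  if k ≤ 0 then 1 else ∑ᶠ L : RSys i₁ i₂ j₁ j₂ k.toNat, RSysWeight x L

/-- `w_I(x)`: the product of all labels in the interval `I = [i₁,i₂] × [j₁,j₂]`. -/
noncomputable def wProd (i₁ i₂ j₁ j₂ : ℤ) (x : ℤ × ℤ → ℝ) : ℝ :=
  ∏ p ∈ Finset.Icc i₁ i₂ ×ˢ Finset.Icc j₁ j₂, x p

/-- The directed edges of the graph `𝒢_R` on vertex set `[1,r+1] × [1,s]`: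
`(i,j) → (i+1,j)` for `(i,j) ∈ R`, and `(i,j) → (i+1,j-1)` when valid. -/
def GEdge (r s : ℕ) (p q : ℤ × ℤ) : Prop :=
  1 ≤ p.1 ∧ p.1 ≤ (r : ℤ) ∧ 1 ≤ p.2 ∧ p.2 ≤ (s : ℤ) ∧ q.1 = p.1 + 1 ∧
    (q.2 = p.2 ∨ (q.2 = p.2 - 1 ∧ 2 ≤ p.2))

/-- The weight of an edge of `𝒢_R`: `x_p⁻¹` for vertical edges, `1` for diagonal ones. -/
noncomputable def edgeWt (x : ℤ × ℤ → ℝ) (p q : ℤ × ℤ) : ℝ :=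
  if q.2 = p.2 then (x p)⁻¹ else 1

/-- The weight of a directed path in `𝒢_R`, given as its list of vertices. -/
noncomputable def listWt (x : ℤ × ℤ → ℝ) (l : List (ℤ × ℤ)) : ℝ :=
  ((l.zip l.tail).map fun e => edgeWt x e.1 e.2).prod

/-- The boundary vertex `P_t` of `𝒢_R`: `P_j = (1,j)` for `1 ≤ j ≤ s`, `P_{s+i} = (i+1,s)`. -/
def Pvert (s : ℕ) (t : ℤ) : ℤ × ℤ := if t ≤ (s : ℤ) then (1, t) else (t - s + 1, (s : ℤ))

/-- The boundary vertex `Q_t` of `𝒢_R`: `Q_i = (i,1)` for `1 ≤ i ≤ r`, `Q_{r+j} = (r+1,j)`. -/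
def Qvert (r : ℕ) (t : ℤ) : ℤ × ℤ := if t ≤ (r : ℤ) then (t, 1) else ((r : ℤ) + 1, t - r)

/-- A collection of `k` pairwise vertex-disjoint directed paths in `𝒢_R` from
`{P_i, …, P_{i+k-1}}` to `{Q_j, …, Q_{j+k-1}}`. -/
structure GSys (r s : ℕ) (i j : ℤ) (k : ℕ) where
  perm : Equiv.Perm (Fin k)
  path : Fin k → List (ℤ × ℤ)
  chain : ∀ t, (path t).Chain' (GEdge r s)
  first : ∀ t : Fin k, (path t).head? = some (Pvert s (i + ((t : ℕ) : ℤ)))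
  final : ∀ t : Fin k, (path t).getLast? = some (Qvert r (j + (((perm t) : ℕ) : ℤ)))
  disjoint : ∀ t t' : Fin k, t ≠ t' → ∀ v ∈ path t, v ∉ path t'

/-- The weight of a collection of paths in `𝒢_R`: the product of the weights of all
edges used. -/
noncomputable def GSysWeight (x : ℤ × ℤ → ℝ) {r s : ℕ} {i j : ℤ} {k : ℕ}
    (L : GSys r s i j k) : ℝ :=
  ∏ t : Fin k, listWt x (L.path t)

/-- `W_{ij}^{(k)}(x)`: total weight of all collections of `k` nonintersecting paths in
`𝒢_R` from `{P_i,…,P_{i+k-1}}` to `{Q_j,…,Q_{j+k-1}}`; `W_{ij}^{(0)} = 1`, and `0` when an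
out-of-range index occurs. -/
noncomputable def W (r s : ℕ) (x : ℤ × ℤ → ℝ) (i j k : ℤ) : ℝ :=
  if k < 0 then 0
  else if k = 0 then 1
  else if 1 ≤ i ∧ 1 ≤ j ∧ i + k - 1 ≤ (r : ℤ) + s ∧ j + k - 1 ≤ (r : ℤ) + s then
    ∑ᶠ L : GSys r s i j k.toNat, GSysWeight x L
  else 0

/-- `l` lists the vertices of a lattice path from `p` which leaves row `r` in column `b`. -/
def IsExitPath (r b : ℤ) : ℤ × ℤ → List (ℤ × ℤ) → Prop
  | p, [] => p = (r + 1, b)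
  | p, v :: l => v = p ∧ p.1 ≤ r ∧
      (IsExitPath r b (p.1 + 1, p.2) l ∨ IsExitPath r b (p.1, p.2 + 1) l)

theorem IsExitPath.snd_le {r b : ℤ} {l : List (ℤ × ℤ)} :
    ∀ {p : ℤ × ℤ}, IsExitPath r b p l → p.2 ≤ b := by
  induction l with
  | nil => intro p h; simp only [IsExitPath] at h; simp [h]
  | cons v l ih =>
    rintro p ⟨-, -, h | h⟩ <;> have := ih h <;> simp only at this <;> omega

theorem IsExitPath.le_of_mem {r b : ℤ} {l : List (ℤ × ℤ)} :
    ∀ {p : ℤ × ℤ}, IsExitPath r b p l → ∀ v ∈ l, p.1 ≤ v.1 ∧ p.2 ≤ v.2 := by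
  induction l with
  | nil => simp
  | cons v l ih =>
    rintro p ⟨rfl, -, h⟩ v' hv'
    rcases List.mem_cons.1 hv' with rfl | hv'
    · simp
    · rcases h with h | h <;> have := ih h v' hv' <;> simp only at this <;> omega

theorem IsExitPath.exists_cons {r b : ℤ} {l : List (ℤ × ℤ)} {p : ℤ × ℤ}
    (h : IsExitPath r b p l) (hp : p.1 ≤ r) :
    ∃ l', l = p :: l' ∧
      (IsExitPath r b (p.1 + 1, p.2) l' ∨ IsExitPath r b (p.1, p.2 + 1) l') := by
  cases l with
  | nil =>
    simp only [IsExitPath] at h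
    rw [h] at hp
    simp at hp
  | cons v l =>
    obtain ⟨rfl, -, h⟩ := h
    exact ⟨l, rfl, h⟩

theorem IsExitPath.bounds_of_mem {r b : ℤ} {l : List (ℤ × ℤ)} :
    ∀ {p : ℤ × ℤ}, IsExitPath r b p l → ∀ v ∈ l, v.1 ≤ r ∧ v.2 ≤ b := by
  induction l with
  | nil => simp
  | cons v l ih =>
    intro p h v' hv'
    rcases List.mem_cons.1 hv' with rfl | hv'
    · have := h.snd_le
      obtain ⟨rfl, h1, -⟩ := h
      exact ⟨h1, this⟩
    · obtain ⟨rfl, -, h⟩ := h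
      rcases h with h | h <;> exact ih h v' hv'

theorem isExitPath_iff {r b : ℤ} {l : List (ℤ × ℤ)} :
    ∀ {p : ℤ × ℤ}, p.1 ≤ r → (IsExitPath r b p l ↔
      l.IsChain CoverStep ∧ l.head? = some p ∧ l.getLast? = some (r, b) ∧ ∀ v ∈ l, v.1 ≤ r) := by
  induction l with
  | nil =>
    intro p hp
    simp only [IsExitPath, List.head?_nil]
    constructor
    · intro h; rw [h] at hp; simp at hp
    · rintro ⟨-, h, -⟩; simp at h
  | cons v l ih =>
    intro p hp
    cases l with
    | nil =>
      simp only [IsExitPath, List.head?_cons, List.getLast?_singleton, Option.some.injEq,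
        List.mem_singleton, forall_eq]
      constructor
      · rintro ⟨rfl, h1, h2⟩
        simp only [Prod.ext_iff] at h2 ⊢
        exact ⟨List.isChain_singleton _, by simp, by omega, h1⟩
      · rintro ⟨-, rfl, rfl, h⟩
        simp
    | cons v' l =>
      simp only [List.head?_cons, Option.some.injEq]
      rw [IsExitPath]
      rw [show List.IsChain CoverStep (v :: v' :: l) ↔
        CoverStep v v' ∧ List.IsChain CoverStep (v' :: l) from List.isChain_cons_cons]
      rw [show (v :: v' :: l).getLast? = (v' :: l).getLast? from by simp [List.getLast?_cons_cons]]
      have key : ∀ p' : ℤ × ℤ, IsExitPath r b p' (v' :: l) ↔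
          v' = p' ∧ (v' :: l).IsChain CoverStep ∧ (v' :: l).getLast? = some (r, b) ∧
            ∀ w ∈ v' :: l, w.1 ≤ r := by
        intro p'
        constructor
        · intro h
          have h1 : p'.1 ≤ r := h.2.1
          have := (ih h1).1 h
          simp only [List.head?_cons, Option.some.injEq] at this
          tauto
        · rintro ⟨rfl, h1, h2, h3⟩
          have : v'.1 ≤ r := h3 v' (by simp)
          exact (ih this).2 ⟨h1, by simp, h2, h3⟩
      rw [key, key]
      constructor
      · rintro ⟨rfl, h1, h⟩
        refine ⟨⟨?_, by tauto⟩, rfl, by tauto, ?_⟩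
        · rcases h with ⟨h, -⟩ | ⟨h, -⟩ <;> simp [CoverStep, h]
        · intro w hw
          rcases List.mem_cons.1 hw with rfl | hw
          · exact h1
          · rcases h with ⟨-, -, -, h⟩ | ⟨-, -, -, h⟩ <;> exact h w hw
      · rintro ⟨⟨h1, h2⟩, rfl, h3, h4⟩
        refine ⟨rfl, hp, ?_⟩
        have h5 : ∀ w ∈ v' :: l, w.1 ≤ r := fun w hw => h4 w (List.mem_cons_of_mem _ hw)
        rcases h1 with ⟨h, h'⟩ | ⟨h, h'⟩
        · exact Or.inl ⟨Prod.ext h h', h2, h3, h5⟩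
        · exact Or.inr ⟨Prod.ext h h', h2, h3, h5⟩

/-- Families of disjoint paths which start at `p t` and leave row `r` in column `b t`. -/
def IsExitSystem {k : ℕ} (r : ℤ) (b : Fin k → ℤ) (p : Fin k → ℤ × ℤ)
    (P : Fin k → List (ℤ × ℤ)) : Prop :=
  (∀ t, IsExitPath r (b t) (p t) (P t)) ∧
    ∀ t t' : Fin k, t ≠ t' → ∀ v ∈ P t, v ∉ P t'

theorem isExitSystem_cons_iff {k : ℕ} {r : ℤ} {b : Fin k → ℤ} {p : Fin k → ℤ × ℤ} {t : Fin k}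
    (hcol : ∀ t', t < t' → (p t).2 < (p t').2)
    (hmin : ∀ t', (p t).1 < (p t').1 ∨ ((p t).1 = (p t').1 ∧ t ≤ t'))
    (ht : (p t).1 ≤ r) (P : Fin k → List (ℤ × ℤ)) :
    IsExitSystem r b p P ↔ ∃ P',
      (IsExitSystem r b (Function.update p t ((p t).1 + 1, (p t).2)) P' ∨
        IsExitSystem r b (Function.update p t ((p t).1, (p t).2 + 1)) P') ∧
      Function.update P' t (p t :: P' t) = P := by
  constructor
  · rintro ⟨h1, h2⟩
    obtain ⟨l, hl, hl'⟩ := (h1 t).exists_cons ht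
    have hsub : ∀ a, ∀ v ∈ Function.update P t l a, v ∈ P a := by
      intro a v hv
      by_cases ha : a = t
      · subst ha
        rw [Function.update_self] at hv
        rw [hl]
        exact List.mem_cons_of_mem _ hv
      · rwa [Function.update_of_ne ha] at hv
    have hstep : ∀ z, IsExitPath r (b t) z l →
        IsExitSystem r b (Function.update p t z) (Function.update P t l) := by
      intro z hz
      refine ⟨fun a => ?_, fun a a' haa v hv hv' => h2 a a' haa v (hsub _ _ hv) (hsub _ _ hv')⟩
      by_cases ha : a = t
      · subst ha
        simpa using hz
      · simpa [Function.update_of_ne ha] using h1 a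
    refine ⟨Function.update P t l, hl'.imp (hstep _) (hstep _), ?_⟩
    simp [← hl]
  · rintro ⟨P', h, rfl⟩
    have hmain : ∀ z, IsExitSystem r b (Function.update p t z) P' →
        (∀ a, a ≠ t → IsExitPath r (b a) (p a) (P' a)) ∧ IsExitPath r (b t) z (P' t) ∧
          ∀ t t' : Fin k, t ≠ t' → ∀ v ∈ P' t, v ∉ P' t' := by
      rintro z ⟨h1, h2⟩
      refine ⟨fun a ha => ?_, ?_, h2⟩
      · simpa [Function.update_of_ne ha] using h1 a
      · simpa using h1 t
    have hrest : (∀ a, a ≠ t → IsExitPath r (b a) (p a) (P' a)) ∧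
        (IsExitPath r (b t) ((p t).1 + 1, (p t).2) (P' t) ∨
          IsExitPath r (b t) ((p t).1, (p t).2 + 1) (P' t)) ∧
          ∀ t t' : Fin k, t ≠ t' → ∀ v ∈ P' t, v ∉ P' t' := by
      rcases h with h | h <;> have := hmain _ h <;> tauto
    obtain ⟨h1, h2, h3⟩ := hrest
    have hnot : ∀ a, a ≠ t → p t ∉ P' a := by
      intro a ha hmem
      have h4 := (h1 a ha).le_of_mem _ hmem
      rcases hmin a with h5 | ⟨h5, h6⟩
      · omega
      · have := hcol a (lt_of_le_of_ne h6 (Ne.symm ha))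
        omega
    refine ⟨fun a => ?_, fun a a' haa v hv hv' => ?_⟩
    · by_cases ha : a = t
      · subst ha
        rw [Function.update_self]
        exact ⟨rfl, ht, h2⟩
      · rw [Function.update_of_ne ha]
        exact h1 a ha
    · by_cases ha : a = t
      · subst ha
        rw [Function.update_self] at hv
        rw [Function.update_of_ne (Ne.symm haa)] at hv'
        rcases List.mem_cons.1 hv with rfl | hv
        · exact hnot a' (Ne.symm haa) hv'
        · exact h3 _ _ haa v hv hv'
      · rw [Function.update_of_ne ha] at hv
        by_cases ha' : a' = t
        · subst ha'
          rw [Function.update_self] at hv'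
          rcases List.mem_cons.1 hv' with rfl | hv'
          · exact hnot a ha hv
          · exact h3 _ _ haa v hv hv'
        · rw [Function.update_of_ne ha'] at hv'
          exact h3 _ _ haa v hv hv'

theorem prod_update_cons {k : ℕ} (x : ℤ × ℤ → ℝ) (P : Fin k → List (ℤ × ℤ)) (t : Fin k)
    (v : ℤ × ℤ) :
    ∏ a, ((Function.update P t (v :: P t) a).map x).prod = x v * ∏ a, ((P a).map x).prod := by
  rw [← Finset.mul_prod_erase _ _ (Finset.mem_univ t),
    ← Finset.mul_prod_erase _ (fun a => ((P a).map x).prod) (Finset.mem_univ t)]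
  rw [Function.update_self, List.map_cons, List.prod_cons, mul_assoc]
  congr 2
  refine Finset.prod_congr rfl fun a ha => ?_
  rw [Function.update_of_ne (Finset.ne_of_mem_erase ha)]

theorem det_single_row_step {k : ℕ} (N : ℤ × ℤ → ℤ → ℝ) (b : Fin k → ℤ) (p : Fin k → ℤ × ℤ)
    (t : Fin k) (c : ℝ) (z₁ z₂ : ℤ × ℤ)
    (h : ∀ a, N (p t) (b a) = c * (N z₁ (b a) + N z₂ (b a))) :
    Matrix.det (Matrix.of fun a a' => N (p a) (b a')) =
      c * (Matrix.det (Matrix.of fun a a' => N (Function.update p t z₁ a) (b a')) +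
        Matrix.det (Matrix.of fun a a' => N (Function.update p t z₂ a) (b a'))) := by
  set M : Matrix (Fin k) (Fin k) ℝ := Matrix.of fun a a' => N (p a) (b a') with hM
  have hz : ∀ z, (Matrix.of fun a a' => N (Function.update p t z a) (b a')) =
      M.updateRow t fun a' => N z (b a') := by
    intro z
    ext a a'
    by_cases ha : a = t
    · subst ha; simp
    · simp [ha, hM]
  rw [hz, hz, ← Matrix.det_updateRow_add, ← Matrix.det_updateRow_smul]
  congr 1
  ext a a'
  by_cases ha : a = t
  · subst ha; simp [hM, h, mul_add]
  · simp [ha, hM]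

theorem exists_finset_exitSystem_of_end {k : ℕ} (r j J : ℤ) (x : ℤ × ℤ → ℝ)
    (N : ℤ × ℤ → ℤ → ℝ)
    (hN_end : ∀ a b, j ≤ a → b ≤ J → N (r + 1, a) b = if a = b then 1 else 0)
    (b : Fin k → ℤ) (hb : StrictMono b) (hbJ : ∀ t, b t ≤ J) (p : Fin k → ℤ × ℤ)
    (hend : ∀ t, (p t).1 = r + 1) (hp : ∀ t, j ≤ (p t).2)
    (hcol : ∀ t t', t < t' → (p t).2 < (p t').2) :
    ∃ F : Finset (Fin k → List (ℤ × ℤ)), (∀ P, P ∈ F ↔ IsExitSystem r b p P) ∧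
      ∑ P ∈ F, ∏ t, ((P t).map x).prod =
        Matrix.det (Matrix.of fun t t' => N (p t) (b t')) := by
  have hp' : ∀ t, p t = (r + 1, (p t).2) := fun t => Prod.ext (hend t) rfl
  have hN : ∀ t t', N (p t) (b t') = if (p t).2 = b t' then 1 else 0 := fun t t' => by
    rw [hp' t]
    exact hN_end _ _ (hp t) (hbJ t')
  have hpath : ∀ t l, IsExitPath r (b t) (p t) l ↔ l = [] ∧ (p t).2 = b t := by
    intro t l
    cases l with
    | nil =>
      simp only [IsExitPath, true_and]
      rw [Prod.ext_iff]
      simp [hend t]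
    | cons v l =>
      simp only [IsExitPath, reduceCtorEq, false_and, iff_false]
      have := hend t
      omega
  by_cases h : ∀ t, (p t).2 = b t
  · refine ⟨{fun _ => []}, fun P => ?_, ?_⟩
    · simp only [Finset.mem_singleton, IsExitSystem, hpath, h, and_true]
      constructor
      · rintro rfl; simp
      · rintro ⟨h1, -⟩; exact funext h1
    · have : (Matrix.of fun t t' => N (p t) (b t')) = (1 : Matrix (Fin k) (Fin k) ℝ) := by
        ext t t'
        simp [hN, h, hb.injective.eq_iff, Matrix.one_apply]
      rw [this]
      simp
  · refine ⟨∅, fun P => ?_, ?_⟩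
    · simp only [Finset.notMem_empty, IsExitSystem, hpath, false_iff]
      exact fun h' => h fun t => (h'.1 t).2
    · have hmono : StrictMono fun t => (p t).2 := fun t t' h => hcol t t' h
      obtain ⟨t, ht⟩ : ∃ t, ∀ t', (p t).2 ≠ b t' := by
        by_contra! hcon
        apply h
        choose f hf using hcon
        have hfm : StrictMono f := fun t t' htt => by
          rw [← hb.lt_iff_lt, ← hf, ← hf]
          exact hmono htt
        have hfid : f = id := by
          have := Subsingleton.elim (hfm.orderIsoOfSurjective f
            (Finite.surjective_of_injective hfm.injective)) (OrderIso.refl _)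
          exact congrArg DFunLike.coe this
        intro t
        rw [hf, hfid, id]
      rw [Finset.sum_empty, Matrix.det_eq_zero_of_row_eq_zero t]
      intro t'
      simp [hN, ht]

/-- A Lindström–Gessel–Viennot identity. -/
theorem exists_finset_exitSystem {k : ℕ} (r j J : ℤ) (x : ℤ × ℤ → ℝ) (N : ℤ × ℤ → ℤ → ℝ)
    (hN_end : ∀ a b, j ≤ a → b ≤ J → N (r + 1, a) b = if a = b then 1 else 0)
    (hN_step : ∀ p : ℤ × ℤ, ∀ b, 1 ≤ p.1 → p.1 ≤ r → j ≤ p.2 → p.2 ≤ J → b ≤ J →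
      N p b = x p * (N (p.1 + 1, p.2) b + N (p.1, p.2 + 1) b))
    (hN_zero : ∀ (p : ℤ × ℤ) b, 1 ≤ p.1 → b < p.2 → b ≤ J → N p b = 0)
    (b : Fin k → ℤ) (hb : StrictMono b) (hbJ : ∀ t, b t ≤ J) (n : ℕ) :
    ∀ p : Fin k → ℤ × ℤ, (∀ t, 1 ≤ (p t).1 ∧ (p t).1 ≤ r + 1 ∧ j ≤ (p t).2) →
      (∀ t t', t < t' → (p t).2 < (p t').2 ∧ (p t').1 ≤ (p t).1) →
      ∑ t, ((r + 1 - (p t).1).toNat + (J + 1 - (p t).2).toNat) < n →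
      ∃ F : Finset (Fin k → List (ℤ × ℤ)), (∀ P, P ∈ F ↔ IsExitSystem r b p P) ∧
        ∑ P ∈ F, ∏ t, ((P t).map x).prod =
          Matrix.det (Matrix.of fun t t' => N (p t) (b t')) := by
  classical
  induction n with
  | zero => intro p _ _ hn; simp at hn
  | succ n ih =>
    intro p hp hgood hn
    by_cases hJ : ∃ t, J < (p t).2
    · obtain ⟨t, ht⟩ := hJ
      refine ⟨∅, fun P => ?_, ?_⟩
      · simp only [Finset.notMem_empty, false_iff]
        intro h
        have := (h.1 t).snd_le
        have := hbJ t
        omega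
      · rw [Finset.sum_empty, Matrix.det_eq_zero_of_row_eq_zero t]
        intro t'
        have := hbJ t'
        exact hN_zero _ _ (hp t).1 (by omega) this
    push Not at hJ
    by_cases hend : ∀ t, (p t).1 = r + 1
    · exact exists_finset_exitSystem_of_end r j J x N hN_end b hb hbJ p hend
        (fun t => (hp t).2.2) fun t t' h => (hgood t t' h).1
    push Not at hend
    obtain ⟨t₀, ht₀⟩ := hend
    obtain ⟨t, -, ht⟩ := Finset.exists_min_image Finset.univ
      (fun t => toLex ((p t).1, t)) ⟨t₀, Finset.mem_univ _⟩
    have hmin : ∀ t', (p t).1 < (p t').1 ∨ ((p t).1 = (p t').1 ∧ t ≤ t') := fun t' => by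
      simpa [Prod.Lex.toLex_le_toLex] using ht t' (Finset.mem_univ _)
    have htr : (p t).1 ≤ r := by
      have := hmin t₀
      have := (hp t₀).2.1
      omega
    have hrow : ∀ t', t < t' → (p t').1 = (p t).1 := fun t' h => by
      have := (hgood t t' h).2
      have := hmin t'
      omega
    have hmeasure : ∀ z : ℤ × ℤ, (r + 1 - z.1).toNat + (J + 1 - z.2).toNat <
        (r + 1 - (p t).1).toNat + (J + 1 - (p t).2).toNat →
        ∑ a, ((r + 1 - (Function.update p t z a).1).toNat +
          (J + 1 - (Function.update p t z a).2).toNat) < n := by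
      intro z hz
      refine lt_of_lt_of_le ?_ (Nat.lt_succ_iff.1 hn)
      refine Finset.sum_lt_sum (fun a _ => ?_) ⟨t, Finset.mem_univ _, ?_⟩
      · by_cases ha : a = t
        · subst ha
          rw [Function.update_self]
          exact hz.le
        · rw [Function.update_of_ne ha]
      · rw [Function.update_self]
        exact hz
    have hptJ := hJ t
    have hpt := hp t
    obtain ⟨F₁, hF₁, hs₁⟩ := ih (Function.update p t ((p t).1 + 1, (p t).2))
      (by
        intro a
        by_cases ha : a = t
        · subst ha
          simp only [Function.update_self]
          omega
        · rw [Function.update_of_ne ha]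
          exact hp a)
      (by
        intro a a' haa
        have h1 := hgood a a' haa
        by_cases ha : a = t
        · subst ha
          rw [Function.update_self, Function.update_of_ne haa.ne']
          simp only
          omega
        · rw [Function.update_of_ne ha]
          by_cases ha' : a' = t
          · subst ha'
            rw [Function.update_self]
            have := hmin a
            simp only
            omega
          · rw [Function.update_of_ne ha']
            exact h1)
      (hmeasure _ (by simp only; omega))
    obtain ⟨F₂, hF₂, hs₂⟩ : ∃ F : Finset (Fin k → List (ℤ × ℤ)),
        (∀ P, P ∈ F ↔ IsExitSystem r b (Function.update p t ((p t).1, (p t).2 + 1)) P) ∧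
        ∑ P ∈ F, ∏ t, ((P t).map x).prod = Matrix.det (Matrix.of fun a a' =>
          N (Function.update p t ((p t).1, (p t).2 + 1) a) (b a')) := by
      by_cases hcoll : ∃ t', t' ≠ t ∧ p t' = ((p t).1, (p t).2 + 1)
      · obtain ⟨t', htt, ht'⟩ := hcoll
        refine ⟨∅, fun P => ?_, ?_⟩
        · simp only [Finset.notMem_empty, false_iff]
          rintro ⟨h1, h2⟩
          have h3 := h1 t
          have h4 := h1 t'
          rw [Function.update_self] at h3
          rw [Function.update_of_ne htt, ht'] at h4
          obtain ⟨l, hl, -⟩ := h3.exists_cons htr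
          obtain ⟨l', hl', -⟩ := h4.exists_cons htr
          exact h2 t t' htt.symm ((p t).1, (p t).2 + 1) (by simp [hl]) (by simp [hl'])
        · rw [Finset.sum_empty, Matrix.det_zero_of_row_eq htt]
          ext a
          simp [Function.update_of_ne htt, ht']
      · push Not at hcoll
        refine ih _ ?_ ?_ (hmeasure _ (by simp only; omega))
        · intro a
          by_cases ha : a = t
          · subst ha
            simp only [Function.update_self]
            omega
          · rw [Function.update_of_ne ha]
            exact hp a
        · intro a a' haa
          have h1 := hgood a a' haa
          by_cases ha : a = t
          · subst ha
            rw [Function.update_self, Function.update_of_ne haa.ne']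
            have h2 := hcoll a' haa.ne'
            have h3 := hrow a' haa
            have h4 : (p a').2 ≠ (p a).2 + 1 := fun h => h2 (Prod.ext h3 h)
            simp only
            omega
          · rw [Function.update_of_ne ha]
            by_cases ha' : a' = t
            · subst ha'
              rw [Function.update_self]
              simp only
              omega
            · rw [Function.update_of_ne ha']
              exact h1
    refine ⟨(F₁ ∪ F₂).image fun P => Function.update P t (p t :: P t), fun P => ?_, ?_⟩
    · rw [isExitSystem_cons_iff (fun t' h => (hgood t t' h).1) hmin htr, Finset.mem_image]
      simp only [Finset.mem_union, hF₁, hF₂]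
    · rw [Finset.sum_image, Finset.sum_union]
      · simp only [prod_update_cons]
        rw [← Finset.mul_sum, ← Finset.mul_sum, hs₁, hs₂, ← mul_add]
        exact (det_single_row_step N b p t _ _ _ fun a =>
          hN_step _ _ hpt.1 htr hpt.2.2 hptJ (hbJ a)).symm
      · rw [Finset.disjoint_left]
        intro P h1 h2
        have h1 := ((hF₁ P).1 h1).1 t
        have h2 := ((hF₂ P).1 h2).1 t
        rw [Function.update_self] at h1 h2
        obtain ⟨l, hl, -⟩ := h2.exists_cons htr
        rw [hl] at h1
        simpa using h1.1
      · intro P _ P' _ h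
        ext1 a
        have := congrFun h a
        by_cases ha : a = t
        · subst ha
          simpa using this
        · simpa [ha] using this

/-- The sum over all paths from `p` which climb `n` rows and move `d` columns to the right,
weighted by the labels of their vertices except those of the row they end in. -/
noncomputable def exitSum (x : ℤ × ℤ → ℝ) : ℕ → ℕ → ℤ × ℤ → ℝ
  | 0, 0, _ => 1
  | 0, _ + 1, _ => 0
  | n + 1, 0, p => x p * exitSum x n 0 (p.1 + 1, p.2)
  | n + 1, d + 1, p =>
      x p * (exitSum x n (d + 1) (p.1 + 1, p.2) + exitSum x (n + 1) d (p.1, p.2 + 1))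

theorem exists_exitSum (r : ℤ) (x : ℤ × ℤ → ℝ) :
    ∃ N : ℤ × ℤ → ℤ → ℝ, (∀ a b, N (r + 1, a) b = if a = b then 1 else 0) ∧
      (∀ p : ℤ × ℤ, ∀ b, p.1 ≤ r →
        N p b = x p * (N (p.1 + 1, p.2) b + N (p.1, p.2 + 1) b)) ∧
      ∀ (p : ℤ × ℤ) b, b < p.2 → N p b = 0 := by
  refine ⟨fun p b => if p.2 ≤ b then exitSum x (r + 1 - p.1).toNat (b - p.2).toNat p else 0,
    ?_, ?_, ?_⟩
  · intro a b
    rcases lt_trichotomy a b with h | rfl | h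
    · obtain ⟨n, hn⟩ : ∃ n, (b - a).toNat = n + 1 := ⟨(b - a).toNat - 1, by omega⟩
      simp [h.le, h.ne, hn, exitSum]
    · simp [exitSum]
    · simp [h.not_ge, h.ne']
  · intro p b hp
    obtain ⟨n, hn⟩ : ∃ n, (r + 1 - p.1).toNat = n + 1 :=
      ⟨(r + 1 - p.1).toNat - 1, by omega⟩
    have hn' : (r + 1 - (p.1 + 1)).toNat = n := by omega
    rcases lt_trichotomy p.2 b with h | h | h
    · obtain ⟨d, hd⟩ : ∃ d, (b - p.2).toNat = d + 1 := ⟨(b - p.2).toNat - 1, by omega⟩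
      have hd' : (b - (p.2 + 1)).toNat = d := by omega
      simp only [h.le, if_true, hn, hd, hn', hd', show p.2 + 1 ≤ b from h]
      rw [exitSum]
    · simp [h, hn, exitSum, -Int.reduceToNat, ← hn']
    · simp [h.not_ge, show ¬ p.2 + 1 ≤ b by omega]
  · intro p b h
    simp [h.not_ge]

theorem w_eq_det (r : ℕ) (j J k : ℤ) (hk : 0 < k) (hr : 1 ≤ r)
    (x : ℤ × ℤ → ℝ) (N : ℤ × ℤ → ℤ → ℝ)
    (hN_end : ∀ a b, j ≤ a → b ≤ J → N (r + 1, a) b = if a = b then 1 else 0)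
    (hN_step : ∀ p : ℤ × ℤ, ∀ b, 1 ≤ p.1 → p.1 ≤ r → j ≤ p.2 → p.2 ≤ J → b ≤ J →
      N p b = x p * (N (p.1 + 1, p.2) b + N (p.1, p.2 + 1) b))
    (hN_zero : ∀ (p : ℤ × ℤ) b, 1 ≤ p.1 → b < p.2 → b ≤ J → N p b = 0) :
    w 1 r j J k x = Matrix.det (Matrix.of fun t t' : Fin k.toNat =>
      N (1, j + ((t : ℕ) : ℤ)) (J - k + 1 + ((t' : ℕ) : ℤ))) := by
  have hk' : ((k.toNat : ℕ) : ℤ) = k := Int.toNat_of_nonneg hk.le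
  obtain ⟨F, hF, hsum⟩ := exists_finset_exitSystem (k := k.toNat) r j J x N hN_end hN_step hN_zero
    (fun t => J - k + 1 + ((t : ℕ) : ℤ))
    (fun t t' h => by
      have : (t : ℕ) < t' := h
      simp only
      omega)
    (fun t => by
      have := t.2
      omega)
    _ (fun t => (1, j + ((t : ℕ) : ℤ)))
    (fun t => by simp only; omega)
    (fun t t' h => by
      have : (t : ℕ) < t' := h
      simp only
      omega)
    (Nat.lt_succ_self _)
  rw [w, if_neg (not_le.2 hk), ← hsum, ← finsum_mem_finset_eq_sum]
  rw [← finsum_mem_univ]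
  refine finsum_mem_eq_of_bijOn (fun L : RSys 1 r j J k.toNat => L.path) ⟨?_, ?_, ?_⟩ ?_
  · intro L _
    rw [Finset.mem_coe, hF]
    refine ⟨fun t => (isExitPath_iff (by simpa using hr)).2 ⟨L.chain t, L.first t, ?_,
      fun v hv => (L.mem t v hv).2.1⟩, L.disjoint⟩
    rw [L.final t, hk']
  · rintro ⟨⟩ - ⟨⟩ - h
    simpa using h
  · intro P hP
    rw [Finset.mem_coe, hF] at hP
    have h1 := fun t => (isExitPath_iff (by simpa using hr)).1 (hP.1 t)
    refine ⟨⟨P, fun t => (h1 t).1, fun t v hv => ?_, fun t => (h1 t).2.1,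
      fun t => ?_, hP.2⟩, Set.mem_univ _, rfl⟩
    · have h2 := (hP.1 t).le_of_mem v hv
      have h3 := (hP.1 t).bounds_of_mem v hv
      have := t.2
      simp only at h2 h3
      omega
    · rw [(h1 t).2.2.1, hk']
  · intro L _
    rfl

theorem w_shift_eq (r : ℕ) (hr : 1 ≤ r) (u v k : ℤ) (hk0 : 0 ≤ k)
    (x x' y : ℤ × ℤ → ℝ)
    (hy : ∀ i j : ℤ, 1 ≤ i → i ≤ r → u - 1 ≤ j → j ≤ v → 0 < y (i, j))
    (hx₁ : ∀ j, u ≤ j → j ≤ v → x (1, j) = y (1, j) / y (1, j - 1))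
    (hx : ∀ i j : ℤ, 1 < i → i ≤ r → u ≤ j → j ≤ v →
      x (i, j) = y (i, j) / (y (i - 1, j) + y (i, j - 1)))
    (hx'_last : ∀ j, u - 1 ≤ j → j < v → x' (r, j) = y (r, j + 1) / y (r, j))
    (hx' : ∀ i j : ℤ, 1 ≤ i → i < r → u - 1 ≤ j → j < v →
      x' (i, j) = ((y (i + 1, j))⁻¹ + (y (i, j + 1))⁻¹)⁻¹ / y (i, j)) :
    w 1 r u v k x = w 1 r (u - 1) (v - 1) k x' := by
  rcases hk0.eq_or_lt with rfl | hk0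
  · simp [w]
  obtain ⟨N, hN_end, hN_step, hN_zero⟩ := exists_exitSum r x'
  rw [w_eq_det r (u - 1) (v - 1) k hk0 hr x' N (fun a b _ _ => hN_end a b)
    (fun p b _ h _ _ _ => hN_step p b h) (fun p b _ h _ => hN_zero p b h)]
  rw [w_eq_det r u v k hk0 hr x (fun p b => if p.1 = 1 then N (1, p.2 - 1) (b - 1) else
    y (p.1 - 1, p.2 - 1) / y (p.1 - 1, p.2) * N (p.1 - 1, p.2 - 1) (b - 1) -
      N (p.1 - 1, p.2) (b - 1))]
  · congr 1
    ext t t'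
    simp only [Matrix.of_apply, if_true]
    congr 2 <;> ring_nf
  · intro a b ha hb
    have hr0 : (r : ℤ) + 1 ≠ 1 := by omega
    simp only [hr0, if_false, add_sub_cancel_right]
    by_cases hab : b < a
    · rw [hN_zero _ _ (by simpa using hab), hN_zero _ _ (by simp only; omega), if_neg hab.ne']
      ring
    have h1 := hN_step (r, a - 1) (b - 1) le_rfl
    simp only [sub_add_cancel] at h1
    rw [h1, hN_end, hx'_last _ (by omega) (by omega), sub_add_cancel]
    have := (hy r a (by omega) le_rfl (by omega) (by omega)).ne'
    have := (hy r (a - 1) (by omega) le_rfl (by omega) (by omega)).ne'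
    simp only [sub_left_inj]
    field_simp
    ring
  · rintro ⟨i, a⟩ b hi hir ha haJ hb
    simp only at hi hir ha haJ ⊢
    have hy1 := hy i a hi hir (by omega) haJ
    have hy2 := hy i (a - 1) hi hir (by omega) (by omega)
    rw [if_neg (show i + 1 ≠ 1 by omega), add_sub_cancel_right, add_sub_cancel_right]
    by_cases hi1 : i = 1
    · subst hi1
      rw [if_pos rfl, if_pos rfl, hx₁ a ha haJ]
      field_simp
      ring
    · rw [if_neg hi1, if_neg hi1, hx i a (by omega) hir ha haJ]
      have hy3 := hy (i - 1) a (by omega) (by omega) (by omega) haJ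
      have hy4 := hy (i - 1) (a - 1) (by omega) (by omega) (by omega) (by omega)
      have h1 := hN_step (i - 1, a - 1) (b - 1) (by simp only; omega)
      have h2 := hN_step (i - 1, a) (b - 1) (by simp only; omega)
      simp only [sub_add_cancel] at h1 h2
      rw [hx' _ _ (by omega) (by omega) (by omega) (by omega)] at h1
      simp only [sub_add_cancel] at h1
      have h3 : y (i - 1, a) / y (i - 1, a + 1) * N (i - 1, a) (b - 1) -
          N (i - 1, a + 1) (b - 1) - N (i, a) (b - 1) =
          -(y (i - 1, a) / y (i, a) * N (i - 1, a) (b - 1)) := by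
        rcases haJ.eq_or_lt with rfl | haJ
        · rw [hN_zero _ _ (by simp only; omega), hN_zero _ _ (by simp only; omega),
            hN_zero _ _ (by simp only; omega)]
          simp
        · have hy5 := hy (i - 1) (a + 1) (by omega) (by omega) (by omega) (by omega)
          rw [h2, hx' _ _ (by omega) (by omega) (by omega) (by omega)]
          simp only [sub_add_cancel]
          field_simp
          ring
      have h4 : N (i, a - 1) (b - 1) = (y (i - 1, a - 1) / y (i, a - 1) +
          y (i - 1, a - 1) / y (i - 1, a)) * N (i - 1, a - 1) (b - 1) -
          N (i - 1, a) (b - 1) := by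
        rw [h1]
        field_simp
        ring
      rw [h4]
      rw [show ∀ A B C : ℝ, A - N (i, a) (b - 1) + (B - C) =
        A + (B - C - N (i, a) (b - 1)) from fun A B C => by ring, h3]
      field_simp
      ring
  · rintro ⟨i, a⟩ b hi ha hb
    simp only at hi ha ⊢
    rw [hN_zero _ _ (by simp only; omega), hN_zero _ _ (by simp only; omega),
      hN_zero _ _ (by simp only; omega)]
    simp

theorem toggle_self (r s : ℕ) (p : ℤ × ℤ) (x : ℤ × ℤ → ℝ) :
    toggle r s p x p = usum r s x p * dsum r s x p / x p := if_pos rfl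

theorem toggle_of_ne {r s : ℕ} {p q : ℤ × ℤ} (h : q ≠ p) (x : ℤ × ℤ → ℝ) :
    toggle r s p x q = x q := if_neg h

theorem foldl_toggle_of_notMem {r s : ℕ} {L : List (ℤ × ℤ)} {q : ℤ × ℤ} :
    ∀ (x : ℤ × ℤ → ℝ), q ∉ L → L.foldl (fun y p => toggle r s p y) x q = x q := by
  induction L with
  | nil => simp
  | cons p L ih =>
    intro x h
    rw [List.mem_cons, not_or] at h
    rw [List.foldl_cons, ih _ h.2, toggle_of_ne h.1]

theorem usum_pos {r s : ℕ} {x : ℤ × ℤ → ℝ} (hx : ∀ p, inR r s p → 0 < x p) (p : ℤ × ℤ) :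
    0 < usum r s x p := by
  unfold usum
  split_ifs with h
  · exact inv_pos.2 (Finset.sum_pos (fun q hq => inv_pos.2 (hx q (Finset.mem_filter.1 hq).2)) h)
  · exact one_pos

theorem dsum_pos {r s : ℕ} {x : ℤ × ℤ → ℝ} (hx : ∀ p, inR r s p → 0 < x p) (p : ℤ × ℤ) :
    0 < dsum r s x p := by
  unfold dsum
  split_ifs with h
  · exact Finset.sum_pos (fun q hq => hx q (Finset.mem_filter.1 hq).2) h
  · exact one_pos

theorem foldl_toggle_pos {r s : ℕ} {L : List (ℤ × ℤ)} :
    ∀ {x : ℤ × ℤ → ℝ}, (∀ p, inR r s p → 0 < x p) → ∀ p, inR r s p →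
      0 < L.foldl (fun y p => toggle r s p y) x p := by
  induction L with
  | nil => simp
  | cons q L ih =>
    intro x hx
    refine ih fun p hp => ?_
    change 0 < toggle r s q x p
    by_cases h : p = q
    · subst h
      rw [toggle_self]
      exact div_pos (mul_pos (usum_pos hx p) (dsum_pos hx p)) (hx p hp)
    · rw [toggle_of_ne h]
      exact hx p hp

theorem usum_congr {r s : ℕ} {x y : ℤ × ℤ → ℝ} {p : ℤ × ℤ}
    (h : ∀ q ∈ upSet r s p, x q = y q) : usum r s x p = usum r s y p := by
  rw [usum, usum, Finset.sum_congr rfl fun q hq => by rw [h q hq]]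

theorem dsum_congr {r s : ℕ} {x y : ℤ × ℤ → ℝ} {p : ℤ × ℤ}
    (h : ∀ q ∈ downSet r s p, x q = y q) : dsum r s x p = dsum r s y p := by
  rw [dsum, dsum, Finset.sum_congr rfl h]

theorem rectList_eq (a b : ℕ) :
    rectList a b = (List.range a).reverse.flatMap fun i : ℕ =>
      (List.range b).reverse.map fun j : ℕ => ((i : ℤ) + 1, (j : ℤ) + 1) := by
  simp only [rectList, List.bind_eq_flatMap, List.pure_def, ← List.map_eq_flatMap, List.flatMap_map,
    List.map_map, Function.comp_def]

theorem mem_rectList {a b : ℕ} {p : ℤ × ℤ} : p ∈ rectList a b ↔ inR a b p := by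
  simp only [rectList_eq, List.mem_flatMap, List.mem_reverse, List.mem_range, List.mem_map, inR]
  constructor
  · rintro ⟨i, hi, j, hj, rfl⟩
    simp only
    omega
  · intro h
    exact ⟨(p.1 - 1).toNat, by omega, (p.2 - 1).toNat, by omega,
      Prod.ext (by simp only; omega) (by simp only; omega)⟩

theorem pairwise_reverse_rectList (a b : ℕ) :
    (rectList a b).reverse.Pairwise fun p q => toLex p < toLex q := by
  rw [List.pairwise_reverse, rectList_eq, List.pairwise_flatMap]
  constructor
  · intro i _
    rw [List.pairwise_map, List.pairwise_reverse]
    refine List.pairwise_lt_range.imp fun h => ?_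
    rw [Prod.Lex.toLex_lt_toLex]
    exact Or.inr ⟨rfl, by simpa using h⟩
  · rw [List.pairwise_reverse]
    refine List.pairwise_lt_range.imp fun h p hp q hq => ?_
    simp only [List.mem_map] at hp hq
    obtain ⟨_, _, rfl⟩ := hp
    obtain ⟨_, _, rfl⟩ := hq
    rw [Prod.Lex.toLex_lt_toLex]
    simp only
    omega

theorem rhoInv_apply (r s : ℕ) (y : ℤ × ℤ → ℝ) {p : ℤ × ℤ} (hp : inR r s p) :
    rhoInv r s y p = usum r s y p * dsum r s (rhoInv r s y) p / y p := by
  have hpm : p ∈ (rectList r s).reverse := List.mem_reverse.2 (mem_rectList.2 hp)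
  obtain ⟨L₁, L₂, hL⟩ := List.append_of_mem hpm
  have hpw := pairwise_reverse_rectList r s
  rw [hL, List.pairwise_append, List.pairwise_cons] at hpw
  obtain ⟨-, ⟨h₂, -⟩, h₁⟩ := hpw
  have hmem : ∀ q, inR r s q ↔ q ∈ L₁ ∨ q = p ∨ q ∈ L₂ := fun q => by
    rw [← mem_rectList, ← List.mem_reverse, hL, List.mem_append, List.mem_cons]
  have hp₁ : p ∉ L₁ := fun h => lt_irrefl _ (h₁ p h p (List.mem_cons_self))
  have hp₂ : p ∉ L₂ := fun h => lt_irrefl _ (h₂ p h)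
  have hrho : rhoInv r s y = L₂.foldl (fun y p => toggle r s p y)
      (toggle r s p (L₁.foldl (fun y p => toggle r s p y) y)) := by
    rw [rhoInv, hL, List.foldl_append, List.foldl_cons]
  set z := L₁.foldl (fun y p => toggle r s p y) y with hz
  have hup : usum r s z p = usum r s y p := usum_congr fun q hq => by
    refine foldl_toggle_of_notMem _ fun h => ?_
    have := h₁ q h p List.mem_cons_self
    simp only [upSet, Finset.mem_filter, Finset.mem_insert, Finset.mem_singleton] at hq
    rw [Prod.Lex.toLex_lt_toLex] at this
    rcases hq.1 with rfl | rfl <;> simp only at this <;> omega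
  have hdown : dsum r s z p = dsum r s (rhoInv r s y) p := dsum_congr fun q hq => by
    simp only [downSet, Finset.mem_filter, Finset.mem_insert, Finset.mem_singleton] at hq
    have hlt : toLex q < toLex p := by
      rw [Prod.Lex.toLex_lt_toLex]
      rcases hq.1 with rfl | rfl <;> simp
    have hne : q ≠ p := fun h => by simp [h] at hlt
    have hq₂ : q ∉ L₂ := fun h => lt_asymm hlt (h₂ q h)
    rw [hrho, foldl_toggle_of_notMem _ hq₂, toggle_of_ne hne]
  rw [← hdown, hrho, foldl_toggle_of_notMem _ hp₂, toggle_self, hup,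
    hz, foldl_toggle_of_notMem _ hp₁]

theorem phi_rhoInv_apply {r s : ℕ} {y : ℤ × ℤ → ℝ} (hy : ∀ p, inR r s p → 0 < y p)
    {p : ℤ × ℤ} (hp : inR r s p) : phi r s (rhoInv r s y) p = usum r s y p / y p := by
  have h : 0 < dsum r s (rhoInv r s y) p := dsum_pos (foldl_toggle_pos hy) p
  rw [phi, rhoInv_apply r s y hp]
  field_simp

/-- The saturated chains from `(1, 1)` to `p`. -/
def chainSet (p : ℤ × ℤ) : Set (List (ℤ × ℤ)) :=
  {l | l.IsChain CoverStep ∧ l.head? = some (1, 1) ∧ l.getLast? = some p}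

theorem phiInv_eq_finsum_mem (x : ℤ × ℤ → ℝ) (p : ℤ × ℤ) :
    phiInv x p = ∑ᶠ l ∈ chainSet p, (l.map x).prod :=
  finsum_set_coe_eq_finsum_mem (f := fun l : List (ℤ × ℤ) => (l.map x).prod) (chainSet p)

theorem one_le_of_mem_chainSet {l : List (ℤ × ℤ)} :
    ∀ {p : ℤ × ℤ}, l ∈ chainSet p → 1 ≤ p.1 ∧ 1 ≤ p.2 := by
  induction l using List.reverseRecOn with
  | nil => simp [chainSet]
  | append_singleton l q ih =>
    rintro p ⟨h1, h2, h3⟩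
    simp only [List.getLast?_append, List.getLast?_singleton, Option.some_or,
      Option.some.injEq] at h3
    subst h3
    cases hl : l.getLast? with
    | none =>
      rw [List.getLast?_eq_none_iff] at hl
      subst hl
      simp at h2
      simp [h2]
    | some v =>
      have hne : l ≠ [] := by rintro rfl; simp at hl
      rw [List.isChain_append] at h1
      have hv := h1.2.2 v hl q (by simp)
      rw [List.head?_append_of_ne_nil _ hne] at h2
      have := ih ⟨h1.1, h2, hl⟩
      rcases hv with hv | hv <;> omega

theorem chainSet_eq {p : ℤ × ℤ} (hp : p ≠ (1, 1)) :
    chainSet p = (fun l => l ++ [p]) '' (chainSet (p.1 - 1, p.2) ∪ chainSet (p.1, p.2 - 1)) := by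
  ext l
  rw [Set.mem_image]
  constructor
  · rintro ⟨h1, h2, h3⟩
    rcases List.eq_nil_or_concat l with rfl | ⟨l, q, rfl⟩
    · simp at h3
    simp only [List.concat_eq_append] at *
    simp only [List.getLast?_append, List.getLast?_singleton, Option.some_or,
      Option.some.injEq] at h3
    subst h3
    refine ⟨l, ?_, rfl⟩
    cases hl : l.getLast? with
    | none =>
      rw [List.getLast?_eq_none_iff] at hl
      subst hl
      simp at h2
      exact absurd h2 hp
    | some v =>
      have hne : l ≠ [] := by rintro rfl; simp at hl
      rw [List.isChain_append] at h1
      have hv := h1.2.2 v hl q (by simp)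
      rw [List.head?_append_of_ne_nil _ hne] at h2
      rcases hv with ⟨hv1, hv2⟩ | ⟨hv1, hv2⟩
      · exact Or.inl ⟨h1.1, h2, hl.trans (congrArg some (Prod.ext (by simp only; omega) hv2.symm))⟩
      · exact Or.inr ⟨h1.1, h2, hl.trans (congrArg some (Prod.ext hv1.symm (by simp only; omega)))⟩
  · rintro ⟨l, hl, rfl⟩
    have hcons : ∀ v, CoverStep v p → l ∈ chainSet v → l ++ [p] ∈ chainSet p := by
      rintro v hv ⟨h1, h2, h3⟩
      have hne : l ≠ [] := by rintro rfl; simp at h2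
      refine ⟨List.isChain_append.2 ⟨h1, List.isChain_singleton _, ?_⟩, ?_, by simp⟩
      · intro v' hv' q hq
        rw [h3] at hv'
        simp only [Option.mem_def, Option.some.injEq, List.head?_cons] at hv' hq
        rwa [← hv', ← hq]
      · rwa [List.head?_append_of_ne_nil _ hne]
    rcases hl with hl | hl
    · exact hcons _ (Or.inl (by simp)) hl
    · exact hcons _ (Or.inr (by simp)) hl

theorem chainSet_one : chainSet (1, 1) = {[(1, 1)]} := by
  ext l
  rw [Set.mem_singleton_iff]
  constructor
  · rintro ⟨h1, h2, h3⟩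
    rcases List.eq_nil_or_concat l with rfl | ⟨l, q, rfl⟩
    · simp at h3
    simp only [List.concat_eq_append] at *
    simp only [List.getLast?_append, List.getLast?_singleton, Option.some_or,
      Option.some.injEq] at h3
    subst h3
    cases hl : l.getLast? with
    | none =>
      rw [List.getLast?_eq_none_iff] at hl
      simp [hl]
    | some v =>
      have hne : l ≠ [] := by rintro rfl; simp at hl
      rw [List.isChain_append] at h1
      have hv := h1.2.2 v hl (1, 1) (by simp)
      rw [List.head?_append_of_ne_nil _ hne] at h2
      have := one_le_of_mem_chainSet ⟨h1.1, h2, hl⟩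
      rcases hv with hv | hv <;> simp only at hv <;> omega
  · rintro rfl
    exact ⟨List.isChain_singleton _, rfl, rfl⟩

theorem chainSet_eq_empty {p : ℤ × ℤ} (hp : ¬(1 ≤ p.1 ∧ 1 ≤ p.2)) : chainSet p = ∅ :=
  Set.eq_empty_of_forall_notMem fun _ h => hp (one_le_of_mem_chainSet h)

theorem chainSet_finite (n : ℕ) : ∀ p : ℤ × ℤ, (p.1 + p.2).toNat < n → (chainSet p).Finite := by
  induction n with
  | zero => intro p h; simp at h
  | succ n ih =>
    intro p h
    by_cases hp : 1 ≤ p.1 ∧ 1 ≤ p.2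
    · by_cases hp1 : p = (1, 1)
      · rw [hp1, chainSet_one]
        exact Set.finite_singleton _
      · rw [chainSet_eq hp1]
        exact ((ih _ (by simp only; omega)).union (ih _ (by simp only; omega))).image _
    · rw [chainSet_eq_empty hp]
      exact Set.finite_empty

theorem phiInv_eq_zero (x : ℤ × ℤ → ℝ) {p : ℤ × ℤ} (hp : ¬(1 ≤ p.1 ∧ 1 ≤ p.2)) :
    phiInv x p = 0 := by
  rw [phiInv_eq_finsum_mem, chainSet_eq_empty hp, finsum_mem_empty]

theorem phiInv_one (x : ℤ × ℤ → ℝ) : phiInv x (1, 1) = x (1, 1) := by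
  rw [phiInv_eq_finsum_mem, chainSet_one, finsum_mem_singleton]
  simp

theorem phiInv_step (x : ℤ × ℤ → ℝ) {p : ℤ × ℤ} (hp : p ≠ (1, 1)) :
    phiInv x p = x p * (phiInv x (p.1 - 1, p.2) + phiInv x (p.1, p.2 - 1)) := by
  have hfin : ∀ p, (chainSet p).Finite := fun p => chainSet_finite _ p (Nat.lt_succ_self _)
  simp only [phiInv_eq_finsum_mem]
  rw [chainSet_eq hp, finsum_mem_image (fun l _ l' _ h => List.append_cancel_right h),
    ← finsum_mem_union _ (hfin _) (hfin _),
    mul_finsum_mem' _ _ ((hfin _).union (hfin _))]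
  · simp [mul_comm]
  · rw [Set.disjoint_left]
    rintro l ⟨-, -, h1⟩ ⟨-, -, h2⟩
    rw [h1] at h2
    simp at h2

theorem phiInv_pos {r s : ℕ} {x : ℤ × ℤ → ℝ} (hx : ∀ p, inR r s p → 0 < x p) (n : ℕ) :
    ∀ p : ℤ × ℤ, (p.1 + p.2).toNat < n → inR r s p → 0 < phiInv x p := by
  induction n with
  | zero => intro p h; simp at h
  | succ n ih =>
    intro p h hp
    have hxp := hx p hp
    unfold inR at hp ih
    by_cases hp1 : p = (1, 1)
    · rw [hp1, phiInv_one, ← hp1]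
      exact hxp
    rw [phiInv_step x hp1]
    refine mul_pos hxp ?_
    by_cases h1 : p.1 = 1
    · have h2 : p.2 ≠ 1 := fun h2 => hp1 (Prod.ext h1 h2)
      rw [phiInv_eq_zero x (p := (p.1 - 1, p.2)) (by simp only; omega), zero_add]
      exact ih _ (by simp only; omega) (by simp only; omega)
    · refine add_pos_of_pos_of_nonneg (ih _ (by simp only; omega) (by simp only; omega)) ?_
      by_cases h2 : p.2 = 1
      · rw [phiInv_eq_zero]
        simp only
        omega
      · exact (ih _ (by simp only; omega) (by simp only; omega)).le

theorem usum_of_lt {r s : ℕ} (y : ℤ × ℤ → ℝ) {i j : ℤ} (hi : 1 ≤ i) (hir : i < r) (hj : 1 ≤ j)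
    (hjs : j < s) : usum r s y (i, j) = ((y (i + 1, j))⁻¹ + (y (i, j + 1))⁻¹)⁻¹ := by
  have : upSet r s (i, j) = {(i + 1, j), (i, j + 1)} := by
    refine Finset.filter_true_of_mem fun q hq => ?_
    simp only [Finset.mem_insert, Finset.mem_singleton] at hq
    rcases hq with rfl | rfl <;> simp only [inR] <;> omega
  rw [usum, this, if_pos (by simp), Finset.sum_pair (by simp)]

theorem usum_last {r s : ℕ} (hr : 1 ≤ r) (y : ℤ × ℤ → ℝ) {j : ℤ} (hj : 1 ≤ j)
    (hjs : j < s) : usum r s y (r, j) = y (r, j + 1) := by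
  have : upSet r s (r, j) = {((r : ℤ), j + 1)} := by
    ext q
    simp only [upSet, Finset.mem_filter, Finset.mem_insert, Finset.mem_singleton]
    constructor
    · rintro ⟨rfl | rfl, h⟩
      · simp [inR] at h
      · rfl
    · rintro rfl
      refine ⟨Or.inr rfl, ?_⟩
      simp only [inR]
      omega
  rw [usum, this, if_pos (by simp), Finset.sum_singleton, inv_inv]

/-- **Chain Shifting Lemma (Lemma 4.1).** For `1 < u ≤ v ≤ s`, `I = [1,r] × [u,v]` and
`I' = [1,r] × [u-1,v-1]`, and any positive labeling `x` of `R = [r] × [s]`,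
`w_I^{(k)}(x) = w_{I'}^{(k)}(φ(ρ⁻¹(φ⁻¹(x))))`. -/
theorem chain_shifting (r s : ℕ) (hr : 1 ≤ r) (hs : 1 ≤ s) (x : ℤ × ℤ → ℝ)
    (hx : ∀ p, inR r s p → 0 < x p) (u v : ℤ) (hu : 1 < u) (huv : u ≤ v)
    (hv : v ≤ (s : ℤ)) (k : ℤ) (hk0 : 0 ≤ k) (hk : k ≤ v - u + 1) :
    w 1 r u v k x = w 1 r (u - 1) (v - 1) k (phi r s (rhoInv r s (phiInv x))) := by
  have hy : ∀ p, inR r s p → 0 < phiInv x p := fun p hp =>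
    phiInv_pos hx _ p (Nat.lt_succ_self _) hp
  refine w_shift_eq r hr u v k hk0 x _ (phiInv x) ?_ ?_ ?_ ?_ ?_
  · intro i j h1 h2 h3 h4
    exact hy _ (by simp only [inR]; omega)
  · intro j h1 h2
    have h0 := hy (1, j - 1) (by simp only [inR]; omega)
    rw [phiInv_step x (p := (1, j)) (by simp; omega),
      phiInv_eq_zero x (p := (1 - 1, j)) (by simp)]
    simp only [zero_add]
    field_simp
  · intro i j h1 h2 h3 h4
    have h5 := hy (i - 1, j) (by simp only [inR]; omega)
    have h6 := hy (i, j - 1) (by simp only [inR]; omega)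
    rw [phiInv_step x (p := (i, j)) (by simp; omega)]
    field_simp
  · intro j h1 h2
    rw [phi_rhoInv_apply hy (by simp only [inR]; omega), usum_last hr _ (by omega) (by omega)]
  · intro i j h1 h2 h3 h4
    rw [phi_rhoInv_apply hy (by simp only [inR]; omega),
      usum_of_lt _ (by omega) (by omega) (by omega) (by omega)]

end Paper
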